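/- Let N ≥ 2, let f : ℂ → ℂ^N be the Veronese map, and fix an integer k with 0 ≤ k ≤ N−2. Set P_k = P(P₊^k f) and g_k = tr(∂P_k · ∂̄P_k). Then at every ζ ∈ ℂ, g_k(ζ) = α_k / (1 + |ζ|²)² where α_k = (k+1)(N−1−k) + k(N−k), and the Gaussian curvature K = −(4/g_k) ∂∂̄ ln g_k is constant and equal to 8/α_k. In particular all surfaces obtained from the Veronese sequence have constant curvature. -/

import Mathlib

open Complex Matrix

/-- Wirtinger derivative ∂ = (∂/∂ζ₁ − i ∂/∂ζ₂)/2 of a map ℂ → ℂ. -/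
noncomputable def wD (f : ℂ → ℂ) (z : ℂ) : ℂ :=
  (fderiv ℝ f z 1 - Complex.I * fderiv ℝ f z Complex.I) / 2

/-- Anti-Wirtinger derivative ∂̄ = (∂/∂ζ₁ + i ∂/∂ζ₂)/2 of a map ℂ → ℂ. -/
noncomputable def wDbar (f : ℂ → ℂ) (z : ℂ) : ℂ :=
  (fderiv ℝ f z 1 + Complex.I * fderiv ℝ f z Complex.I) / 2

/-- Componentwise Wirtinger derivative for vector-valued maps. -/
noncomputable def wDV {N : ℕ} (f : ℂ → Fin N → ℂ) (z : ℂ) : Fin N → ℂ :=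
  fun i => wD (fun w => f w i) z

/-- Componentwise anti-Wirtinger derivative for vector-valued maps. -/
noncomputable def wDbarV {N : ℕ} (f : ℂ → Fin N → ℂ) (z : ℂ) : Fin N → ℂ :=
  fun i => wDbar (fun w => f w i) z

/-- Hermitian inner product a†·b = Σᵢ āᵢ bᵢ on ℂ^N. -/
noncomputable def herm {N : ℕ} (a b : Fin N → ℂ) : ℂ :=
  ∑ i, (starRingEnd ℂ) (a i) * b i

/-- Squared norm |a|² as a real number. -/
noncomputable def nsq {N : ℕ} (a : Fin N → ℂ) : ℝ :=
  ∑ i, Complex.normSq (a i)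

/-- The operator P₊ g = ∂g − g (g†·∂g)/|g|². -/
noncomputable def Pp {N : ℕ} (g : ℂ → Fin N → ℂ) : ℂ → Fin N → ℂ :=
  fun z i => wDV g z i - g z i * (herm (g z) (wDV g z) / herm (g z) (g z))

/-- Iterates of P₊ : P₊⁰ g = g, P₊^{k+1} g = P₊ (P₊^k g). -/
noncomputable def PpIter {N : ℕ} (g : ℂ → Fin N → ℂ) : ℕ → (ℂ → Fin N → ℂ)
  | 0 => g
  | k + 1 => Pp (PpIter g k)

/-- The projector P(V) = V ⊗ V† / |V|². -/
noncomputable def proj {N : ℕ} (V : ℂ → Fin N → ℂ) (z : ℂ) : Matrix (Fin N) (Fin N) ℂ :=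
  fun i j => V z i * (starRingEnd ℂ) (V z j) / herm (V z) (V z)

/-- Entrywise Wirtinger derivative for matrix-valued maps. -/
noncomputable def wDM {N : ℕ} (M : ℂ → Matrix (Fin N) (Fin N) ℂ) (z : ℂ) :
    Matrix (Fin N) (Fin N) ℂ :=
  fun i j => wD (fun w => M w i j) z

/-- Entrywise anti-Wirtinger derivative for matrix-valued maps. -/
noncomputable def wDbarM {N : ℕ} (M : ℂ → Matrix (Fin N) (Fin N) ℂ) (z : ℂ) :
    Matrix (Fin N) (Fin N) ℂ :=
  fun i j => wDbar (fun w => M w i j) z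

open scoped ContDiff

open scoped ComplexConjugate

/-- `f` is real-differentiable at `z` with Wirtinger derivatives `∂f = a` and `∂̄f = b`. -/
def HasWirtingerAt (f : ℂ → ℂ) (a b z : ℂ) : Prop :=
  HasFDerivAt f (a • ContinuousLinearMap.id ℝ ℂ + b • (conjCLE : ℂ →L[ℝ] ℂ)) z

namespace HasWirtingerAt

variable {f g : ℂ → ℂ} {a b c d z : ℂ}

theorem wD_eq (h : HasWirtingerAt f a b z) : wD f z = a := by
  unfold wD
  rw [HasFDerivAt.fderiv h]
  simp
  linear_combination (b - a) / 2 * I_sq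

theorem wDbar_eq (h : HasWirtingerAt f a b z) : wDbar f z = b := by
  unfold wDbar
  rw [HasFDerivAt.fderiv h]
  simp
  linear_combination (a - b) / 2 * I_sq

theorem of_differentiableAt (h : DifferentiableAt ℝ f z) :
    HasWirtingerAt f (wD f z) (wDbar f z) z := by
  refine h.hasFDerivAt.congr_fderiv ?_
  ext v
  have hv : fderiv ℝ f z v = v.re * fderiv ℝ f z 1 + v.im * fderiv ℝ f z I := by
    have : v = v.re • (1 : ℂ) + v.im • I := by simp [re_add_im]
    conv_lhs => rw [this]
    rw [map_add, map_smul, map_smul, real_smul, real_smul]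
  rw [hv]
  have h1 : (conj v) = v.re - v.im * I := by
    apply Complex.ext <;> simp
  simp [wD, wDbar, h1]
  linear_combination ((fderiv ℝ f z 1 - I * fderiv ℝ f z I) / 2) * (re_add_im v) +
      (v.im * fderiv ℝ f z I) * I_sq

theorem congr (h : HasWirtingerAt f a b z) (ha : a = c) (hb : b = d) :
    HasWirtingerAt f c d z := ha ▸ hb ▸ h

protected theorem const (c z : ℂ) : HasWirtingerAt (fun _ => c) 0 0 z := by
  refine (hasFDerivAt_const (𝕜 := ℝ) c z).congr_fderiv ?_
  ext v
  simp

protected theorem id (z : ℂ) : HasWirtingerAt (fun w => w) 1 0 z := by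
  refine (hasFDerivAt_id (𝕜 := ℝ) z).congr_fderiv ?_
  ext v
  simp

protected theorem add (hf : HasWirtingerAt f a b z) (hg : HasWirtingerAt g c d z) :
    HasWirtingerAt (fun w => f w + g w) (a + c) (b + d) z := by
  refine (HasFDerivAt.add hf hg).congr_fderiv ?_
  ext v
  simp
  ring

protected theorem mul (hf : HasWirtingerAt f a b z) (hg : HasWirtingerAt g c d z) :
    HasWirtingerAt (fun w => f w * g w) (a * g z + f z * c) (b * g z + f z * d) z := by
  refine (HasFDerivAt.mul hf hg).congr_fderiv ?_
  ext v
  simp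
  ring

protected theorem starRingEnd (hf : HasWirtingerAt f a b z) :
    HasWirtingerAt (fun w => conj (f w)) (conj b) (conj a) z := by
  refine ((conjCLE : ℂ →L[ℝ] ℂ).hasFDerivAt.comp z hf).congr_fderiv ?_
  ext v
  simp
  ring

protected theorem sum {ι : Type*} {s : Finset ι} {f : ι → ℂ → ℂ} {a b : ι → ℂ}
    (h : ∀ i ∈ s, HasWirtingerAt (f i) (a i) (b i) z) :
    HasWirtingerAt (fun w => ∑ i ∈ s, f i w) (∑ i ∈ s, a i) (∑ i ∈ s, b i) z := by
  refine (HasFDerivAt.fun_sum h).congr_fderiv ?_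
  ext v
  simp [Finset.sum_add_distrib, Finset.sum_mul]

theorem scomp {F : ℂ → ℂ} {F' : ℂ} (hF : HasDerivAt F F' (f z)) (hf : HasWirtingerAt f a b z) :
    HasWirtingerAt (fun w => F (f w)) (F' * a) (F' * b) z := by
  refine ((hF.hasFDerivAt.restrictScalars ℝ).comp z hf).congr_fderiv ?_
  ext v
  simp
  ring

protected theorem inv (hf : HasWirtingerAt f a b z) (h0 : f z ≠ 0) :
    HasWirtingerAt (fun w => (f w)⁻¹) (-(f z ^ 2)⁻¹ * a) (-(f z ^ 2)⁻¹ * b) z :=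
  scomp (hasDerivAt_inv h0) hf

protected theorem div (hf : HasWirtingerAt f a b z) (hg : HasWirtingerAt g c d z)
    (h0 : g z ≠ 0) :
    HasWirtingerAt (fun w => f w / g w) ((a * g z - f z * c) / g z ^ 2)
      ((b * g z - f z * d) / g z ^ 2) z := by
  simp only [div_eq_mul_inv]
  refine (hf.mul (hg.inv h0)).congr ?_ ?_ <;> field_simp <;> ring

protected theorem herm {N : ℕ} {V W : ℂ → Fin N → ℂ} {A B C D : Fin N → ℂ}
    (hV : ∀ i, HasWirtingerAt (fun w => V w i) (A i) (B i) z)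
    (hW : ∀ i, HasWirtingerAt (fun w => W w i) (C i) (D i) z) :
    HasWirtingerAt (fun w => herm (V w) (W w)) (herm B (W z) + herm (V z) C)
      (herm A (W z) + herm (V z) D) z := by
  refine (HasWirtingerAt.sum fun i _ => (hV i).starRingEnd.mul (hW i)).congr ?_ ?_ <;>
  simp [_root_.herm, Finset.sum_add_distrib]

end HasWirtingerAt

theorem ContDiff.wD {f : ℂ → ℂ} (hf : ContDiff ℝ ∞ f) : ContDiff ℝ ∞ (wD f) := by
  have h := hf.fderiv_right (m := ∞) (by simp)
  unfold _root_.wD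
  exact ((h.clm_apply contDiff_const).sub
    (contDiff_const.mul (h.clm_apply contDiff_const))).div_const 2

theorem ContDiff.hasWirtingerAt {f : ℂ → ℂ} (hf : ContDiff ℝ ∞ f) (z : ℂ) :
    HasWirtingerAt f (_root_.wD f z) (_root_.wDbar f z) z :=
  .of_differentiableAt (hf.differentiable (by simp) z)

theorem wDbar_wD_comm {f : ℂ → ℂ} (hf : ContDiff ℝ ∞ f) (z : ℂ) :
    wDbar (wD f) z = wD (wDbar f) z := by
  have hd : DifferentiableAt ℝ (fderiv ℝ f) z :=
    (hf.fderiv_right (m := ∞) (by simp)).differentiable (by simp) z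
  have hsymm : fderiv ℝ (fderiv ℝ f) z 1 I = fderiv ℝ (fderiv ℝ f) z I 1 :=
    (hf.contDiffAt.isSymmSndFDerivAt (by simp; exact WithTop.coe_le_coe.2 le_top)) 1 I
  have h1 (u : ℂ) : HasFDerivAt (fun w => fderiv ℝ f w u)
      ((fderiv ℝ (fderiv ℝ f) z).flip u) z := by
    refine (hd.hasFDerivAt.clm_apply (hasFDerivAt_const u z)).congr_fderiv ?_
    ext; simp
  have h2 : HasFDerivAt (wD f) ((2⁻¹ : ℂ) • ((fderiv ℝ (fderiv ℝ f) z).flip 1 -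
      I • (fderiv ℝ (fderiv ℝ f) z).flip I)) z := by
    refine (((h1 1).sub ((h1 I).const_mul I)).const_mul (2⁻¹ : ℂ)).congr_of_eventuallyEq ?_
    exact .of_forall fun w => by simp [wD]; ring
  have h3 : HasFDerivAt (wDbar f) ((2⁻¹ : ℂ) • ((fderiv ℝ (fderiv ℝ f) z).flip 1 +
      I • (fderiv ℝ (fderiv ℝ f) z).flip I)) z := by
    refine (((h1 1).add ((h1 I).const_mul I)).const_mul (2⁻¹ : ℂ)).congr_of_eventuallyEq ?_
    exact .of_forall fun w => by simp [wDbar]; ring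
  rw [wDbar, wD, h2.fderiv, h3.fderiv]
  simp [hsymm]
  ring

section herm

variable {N : ℕ} (a b c : Fin N → ℂ) (t : ℂ)

theorem herm_add_right : herm a (b + c) = herm a b + herm a c := by
  simp [herm, mul_add, Finset.sum_add_distrib]

theorem herm_smul_right : herm a (t • b) = t * herm a b := by
  simp only [herm, Finset.mul_sum, Pi.smul_apply, smul_eq_mul]
  exact Finset.sum_congr rfl fun i _ => by ring

theorem herm_smul_left : herm (t • a) b = conj t * herm a b := by
  simp [herm, Finset.mul_sum, mul_assoc]

theorem conj_herm : conj (herm a b) = herm b a := by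
  simp [herm, mul_comm]

theorem sum_sum_outer_mul_outer (t D : ℂ) :
    ∑ i, ∑ j, (c i * conj (a j) - t * (a i * conj (b j))) / D *
      ((a j * conj (c i) - t * (b j * conj (a i))) / D) =
    (herm c c * herm a a - t * (herm a c * herm a b) - t * (herm c a * herm b a) +
      t ^ 2 * (herm a a * herm b b)) / D ^ 2 := by
  simp only [div_mul_div_comm, ← Finset.sum_div, ← sq]
  congr 1
  simp only [herm, Finset.sum_mul_sum]
  simp only [Finset.mul_sum, ← Finset.sum_add_distrib,
    ← Finset.sum_sub_distrib]
  exact Finset.sum_congr rfl fun i _ => Finset.sum_congr rfl fun j _ => by ring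

end herm

theorem one_add_mul_conj_ne_zero (z : ℂ) : 1 + z * conj z ≠ 0 := by
  rw [mul_conj]
  exact_mod_cast (by positivity [normSq_nonneg z] : (1 + normSq z : ℝ) ≠ 0)

theorem hasWirtingerAt_conj (z : ℂ) : HasWirtingerAt (fun w => conj w) 0 1 z :=
  (HasWirtingerAt.id z).starRingEnd.congr (by simp) (by simp)

theorem hasWirtingerAt_one_add_mul_conj (z : ℂ) :
    HasWirtingerAt (fun w => 1 + w * conj w) (conj z) z z :=
  ((HasWirtingerAt.const 1 z).add ((HasWirtingerAt.id z).mul (hasWirtingerAt_conj z))).congr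
    (by simp) (by simp)

/-- The connection coefficient `∂ ln |V_k|²` of the Veronese sequence. -/
noncomputable def veroneseConn (n k : ℕ) (z : ℂ) : ℂ :=
  (n - 2 * k) * conj z / (1 + z * conj z)

/-- The ratio `|V_k|² / |V_{k-1}|²` for the Veronese sequence. -/
noncomputable def veroneseRatio (n k : ℕ) (z : ℂ) : ℂ :=
  k * (n - k + 1) / (1 + z * conj z) ^ 2

theorem hasWirtingerAt_veroneseConn (n k : ℕ) (z : ℂ) :
    HasWirtingerAt (veroneseConn n k) (-(n - 2 * k) * conj z ^ 2 / (1 + z * conj z) ^ 2)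
      ((n - 2 * k) / (1 + z * conj z) ^ 2) z := by
  refine ((((HasWirtingerAt.const (n - 2 * k : ℂ) z).mul (hasWirtingerAt_conj z)).div
    (hasWirtingerAt_one_add_mul_conj z) (one_add_mul_conj_ne_zero z))).congr ?_ ?_ <;> ring

theorem hasWirtingerAt_veroneseRatio (n k : ℕ) (z : ℂ) :
    HasWirtingerAt (veroneseRatio n k) (-2 * conj z / (1 + z * conj z) * veroneseRatio n k z)
      (-2 * z / (1 + z * conj z) * veroneseRatio n k z) z := by
  have h0 := one_add_mul_conj_ne_zero z
  refine ((HasWirtingerAt.const (k * (n - k + 1) : ℂ) z).div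
    (HasWirtingerAt.scomp (hasDerivAt_pow 2 _) (hasWirtingerAt_one_add_mul_conj z))
    (pow_ne_zero 2 h0)).congr ?_ ?_ <;> simp only [veroneseRatio] <;> field_simp <;> ring

theorem conj_veroneseRatio (n k : ℕ) (z : ℂ) :
    conj (veroneseRatio n k z) = veroneseRatio n k z := by
  simp [veroneseRatio, mul_comm]

theorem contDiff_veroneseConn (n k : ℕ) : ContDiff ℝ ∞ (veroneseConn n k) := by
  have hc : ContDiff ℝ ∞ (fun w : ℂ => conj w) := conjCLE.contDiff
  have hs : ContDiff ℝ ∞ (fun w : ℂ => 1 + w * conj w) :=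
    contDiff_const.add (contDiff_id.mul hc)
  unfold veroneseConn
  simp only [div_eq_mul_inv]
  exact (contDiff_const.mul hc).mul (hs.inv one_add_mul_conj_ne_zero)

/-- The properties of the `k`-th element `V` of the Veronese sequence in `ℂ^(n+1)`,
with predecessor `U` (which is irrelevant when `k = 0`). -/
structure IsVeroneseStep (n k : ℕ) {N : ℕ} (V U : ℂ → Fin N → ℂ) : Prop where
  contDiff : ∀ i, ContDiff ℝ ∞ fun w => V w i
  contDiff_prev : ∀ i, ContDiff ℝ ∞ fun w => U w i
  herm_ne_zero : ∀ z, herm (V z) (V z) ≠ 0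
  wD_herm : ∀ z, wD (fun w => herm (V w) (V w)) z = veroneseConn n k z * herm (V z) (V z)
  wDbar_apply : ∀ z i, wDbar (fun w => V w i) z = -veroneseRatio n k z * U z i
  herm_prev : ∀ z, herm (V z) (U z) = 0
  wD_prev : ∀ z i, k * wD (fun w => U w i) z = k * (V z i + (n - 2 * k + 2) * conj z /
    (1 + z * conj z) * U z i)
  herm_self : ∀ z, k * (veroneseRatio n k z * herm (U z) (U z)) = k * herm (V z) (V z)

namespace IsVeroneseStep

variable {n k N : ℕ} {V U : ℂ → Fin N → ℂ}

theorem herm_wDV (h : IsVeroneseStep n k V U) (z : ℂ) :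
    herm (V z) (wDV V z) = veroneseConn n k z * herm (V z) (V z) := by
  have hV i := (h.contDiff i).hasWirtingerAt z
  rw [← h.wD_herm, (HasWirtingerAt.herm hV hV).wD_eq]
  have : (fun i => wDbar (fun w => V w i) z) = (-veroneseRatio n k z) • U z :=
    funext fun i => h.wDbar_apply z i
  rw [this, herm_smul_left, ← conj_herm (V z), h.herm_prev]
  rw [map_zero, mul_zero, zero_add]
  rfl

theorem Pp_apply (h : IsVeroneseStep n k V U) (z : ℂ) (i : Fin N) :
    Pp V z i = wD (fun w => V w i) z - V z i * veroneseConn n k z := by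
  rw [Pp, h.herm_wDV, mul_div_cancel_right₀ _ (h.herm_ne_zero z), wDV]

theorem hasWirtingerAt (h : IsVeroneseStep n k V U) (z : ℂ) (i : Fin N) :
    HasWirtingerAt (fun w => V w i) ((Pp V z + veroneseConn n k z • V z) i)
      ((-veroneseRatio n k z • U z) i) z :=
  ((h.contDiff i).hasWirtingerAt z).congr (by simp [h.Pp_apply, mul_comm])
    (by simp [h.wDbar_apply])

theorem herm_Pp_right (h : IsVeroneseStep n k V U) (z : ℂ) : herm (V z) (Pp V z) = 0 := by
  have h1 : wDV V z = Pp V z + veroneseConn n k z • V z :=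
    funext fun i => (h.hasWirtingerAt z i).wD_eq
  have h2 := h.herm_wDV z
  rw [h1, herm_add_right, herm_smul_right] at h2
  linear_combination h2

theorem herm_Pp_left (h : IsVeroneseStep n k V U) (z : ℂ) : herm (Pp V z) (V z) = 0 := by
  rw [← conj_herm, h.herm_Pp_right, map_zero]

theorem contDiff_Pp (h : IsVeroneseStep n k V U) (i : Fin N) :
    ContDiff ℝ ∞ fun w => Pp V w i := by
  simp only [h.Pp_apply]
  exact (h.contDiff i).wD.sub ((h.contDiff i).mul (contDiff_veroneseConn n k))

theorem wDbar_Pp (h : IsVeroneseStep n k V U) (z : ℂ) (i : Fin N) :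
    wDbar (fun w => Pp V w i) z = -veroneseRatio n (k + 1) z * V z i := by
  have h0 := one_add_mul_conj_ne_zero z
  have hbar : wDbar (fun w => V w i) = fun w => (-1) * (veroneseRatio n k w * U w i) :=
    funext fun w => by rw [h.wDbar_apply]; ring
  have hP : (fun w => Pp V w i) = fun w => wD (fun w => V w i) w +
      (-1) * (V w i * veroneseConn n k w) := funext fun w => by rw [h.Pp_apply]; ring
  have h1 := ((h.contDiff i).wD.hasWirtingerAt z).add ((HasWirtingerAt.const (-1) z).mul
    ((h.hasWirtingerAt z i).mul (hasWirtingerAt_veroneseConn n k z)))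
  rw [hP, h1.wDbar_eq, wDbar_wD_comm (h.contDiff i), hbar,
    ((HasWirtingerAt.const (-1) z).mul ((hasWirtingerAt_veroneseRatio n k z).mul
      ((h.contDiff_prev i).hasWirtingerAt z))).wD_eq]
  have h2 := h.wD_prev z i
  simp only [veroneseRatio, veroneseConn, Pi.smul_apply, smul_eq_mul]
  push_cast
  generalize wD (fun w => U w i) z = X at *
  have h3 : (k : ℂ) * X * (1 + z * conj z) =
    k * (V z i * (1 + z * conj z) + (n - 2 * k + 2) * conj z * U z i) := by
    have h4 : (n - 2 * k + 2) * conj z / (1 + z * conj z) * U z i * (1 + z * conj z) =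
        (n - 2 * k + 2) * conj z * U z i := by
      rw [div_mul_eq_mul_div, div_mul_cancel₀ _ h0]
    rw [h2]
    linear_combination (k : ℂ) * h4
  field_simp
  linear_combination (-(n - k + 1) : ℂ) * h3

theorem herm_Pp_self (h : IsVeroneseStep n k V U) (z : ℂ) :
    veroneseRatio n (k + 1) z * herm (V z) (V z) = herm (Pp V z) (Pp V z) := by
  have hP i := (h.contDiff_Pp i).hasWirtingerAt z
  have h1 := (HasWirtingerAt.herm hP (h.hasWirtingerAt z)).wD_eq
  simp only [h.herm_Pp_left] at h1
  have : (fun i => wDbar (fun w => Pp V w i) z) = (-veroneseRatio n (k + 1) z) • V z :=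
    funext fun i => h.wDbar_Pp z i
  rw [(HasWirtingerAt.const 0 z).wD_eq, this, herm_smul_left, herm_add_right, herm_smul_right,
    h.herm_Pp_left, map_neg, conj_veroneseRatio] at h1
  linear_combination h1

/-- The operator `P₊` advances the Veronese sequence. -/
theorem succ (h : IsVeroneseStep n k V U) (hk : k < n) :
    IsVeroneseStep n (k + 1) (Pp V) V where
  contDiff := h.contDiff_Pp
  contDiff_prev := h.contDiff
  herm_ne_zero z := by
    rw [← h.herm_Pp_self]
    refine mul_ne_zero (div_ne_zero (mul_ne_zero ?_ ?_)
      (pow_ne_zero 2 (one_add_mul_conj_ne_zero z))) (h.herm_ne_zero z)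
    · exact_mod_cast k.succ_ne_zero
    · push_cast
      rw [sub_add_eq_sub_sub, sub_add_cancel, sub_ne_zero]
      exact_mod_cast hk.ne'
  wD_herm z := by
    have hV := (h.contDiff · |>.hasWirtingerAt z)
    have hD := HasWirtingerAt.herm hV hV
    have hD' := hD.congr (hD.wD_eq.symm.trans (h.wD_herm z)) rfl
    simp only [← h.herm_Pp_self]
    rw [((hasWirtingerAt_veroneseRatio n (k + 1) z).mul hD').wD_eq]
    have h0 := one_add_mul_conj_ne_zero z
    simp only [veroneseConn]
    push_cast
    field_simp
    ring
  wDbar_apply := h.wDbar_Pp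
  herm_prev := h.herm_Pp_left
  wD_prev z i := by
    rw [(h.hasWirtingerAt z i).wD_eq]
    simp only [veroneseConn, Pi.add_apply, Pi.smul_apply, smul_eq_mul]
    push_cast
    ring
  herm_self z := by rw [h.herm_Pp_self]

theorem ratio_mul_herm_prev (h : IsVeroneseStep n k V U) (z : ℂ) :
    veroneseRatio n k z ^ 2 * herm (U z) (U z) = veroneseRatio n k z * herm (V z) (V z) := by
  have h1 := h.herm_self z
  have h2 : veroneseRatio n k z = k * ((n - k + 1) / (1 + z * conj z) ^ 2) := by
    rw [veroneseRatio, mul_div_assoc]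
  calc _ = ((n - k + 1) / (1 + z * conj z) ^ 2) *
        (k * (veroneseRatio n k z * herm (U z) (U z))) := by rw [sq]; nth_rw 1 [h2]; ring
    _ = _ := by rw [h1, h2]; ring

theorem hasWirtingerAt_proj (h : IsVeroneseStep n k V U) (z : ℂ) (i j : Fin N) :
    HasWirtingerAt (fun w => proj V w i j)
      ((Pp V z i * conj (V z j) - veroneseRatio n k z * (V z i * conj (U z j))) /
        herm (V z) (V z))
      ((V z i * conj (Pp V z j) - veroneseRatio n k z * (U z i * conj (V z j))) /
        herm (V z) (V z)) z := by
  have hV := h.hasWirtingerAt z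
  have h0 := h.herm_ne_zero z
  have hUV : herm (U z) (V z) = 0 := by rw [← conj_herm, h.herm_prev, map_zero]
  have hPV := h.herm_Pp_left z
  refine (((hV i).mul (hV j).starRingEnd).div (HasWirtingerAt.herm hV hV) h0).congr ?_ ?_
  · simp only [herm_add_right, herm_smul_right, herm_smul_left, hUV, h.herm_Pp_right,
      Pi.add_apply, Pi.smul_apply, smul_eq_mul, map_mul, map_neg, conj_veroneseRatio]
    field_simp
    ring
  · have e : herm (Pp V z + veroneseConn n k z • V z) (V z) =
        conj (veroneseConn n k z) * herm (V z) (V z) := by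
      rw [← conj_herm, herm_add_right, herm_smul_right, h.herm_Pp_right, zero_add, map_mul,
        conj_herm]
    simp only [e, herm_smul_right, h.herm_prev,
      Pi.add_apply, Pi.smul_apply, smul_eq_mul, map_mul, map_add]
    field_simp
    ring

theorem trace_wDM_mul_wDbarM (h : IsVeroneseStep n k V U) (z : ℂ) :
    trace (wDM (proj V) z * wDbarM (proj V) z) =
      veroneseRatio n (k + 1) z + veroneseRatio n k z := by
  have h0 := h.herm_ne_zero z
  simp only [trace, diag_apply, mul_apply, wDM, wDbarM, (h.hasWirtingerAt_proj z _ _).wD_eq,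
    (h.hasWirtingerAt_proj z _ _).wDbar_eq]
  rw [sum_sum_outer_mul_outer, h.herm_Pp_left, h.herm_Pp_right, ← h.herm_Pp_self,
    div_eq_iff (pow_ne_zero 2 h0)]
  linear_combination herm (V z) (V z) * h.ratio_mul_herm_prev z

end IsVeroneseStep

theorem isVeroneseStep_zero (n : ℕ) :
    IsVeroneseStep n 0 (fun (z : ℂ) (j : Fin (n + 1)) => (√(n.choose j) : ℂ) * z ^ (j : ℕ)) 0 := by
  have hn (z : ℂ) : herm (fun j : Fin (n + 1) => (√(n.choose j) : ℂ) * z ^ (j : ℕ))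
      (fun j => (√(n.choose j) : ℂ) * z ^ (j : ℕ)) = (1 + z * conj z) ^ n := by
    rw [add_comm 1, add_pow, herm, ← Fin.sum_univ_eq_sum_range
      (fun j => (z * conj z) ^ j * 1 ^ (n - j) * (n.choose j : ℂ))]
    refine Finset.sum_congr rfl fun j _ => ?_
    have : (√(n.choose j) : ℂ) * √(n.choose j) = n.choose j := by
      exact_mod_cast Real.mul_self_sqrt (Nat.cast_nonneg (n.choose j))
    simp only [map_mul, map_pow, conj_ofReal, one_pow, ← this, mul_pow]
    ring
  refine ⟨fun i => ?_, fun i => contDiff_const, fun z => ?_, fun z => ?_, fun z i => ?_,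
    fun z => by simp [herm], fun z i => by simp, fun z => by simp⟩
  · exact contDiff_const.mul (contDiff_id.pow _)
  · rw [hn]
    exact pow_ne_zero _ (one_add_mul_conj_ne_zero z)
  · have h0 := one_add_mul_conj_ne_zero z
    simp only [hn]
    rw [(HasWirtingerAt.scomp (hasDerivAt_pow n _) (hasWirtingerAt_one_add_mul_conj z)).wD_eq]
    rcases n with _ | n
    · simp [veroneseConn]
    · simp [veroneseConn, pow_succ]
      field_simp
  · rw [((HasWirtingerAt.const _ z).mul
      (HasWirtingerAt.scomp (hasDerivAt_pow i z) (HasWirtingerAt.id z))).wDbar_eq]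
    simp

theorem exists_isVeroneseStep_PpIter (n k : ℕ) (hk : k ≤ n) :
    ∃ U, IsVeroneseStep n k (PpIter (fun (z : ℂ) (j : Fin (n + 1)) =>
      (√(n.choose j) : ℂ) * z ^ (j : ℕ)) k) U := by
  induction k with
  | zero => exact ⟨0, isVeroneseStep_zero n⟩
  | succ k ih =>
    obtain ⟨U, hU⟩ := ih (by omega)
    exact ⟨_, hU.succ (by omega)⟩

/-- The Wirtinger Laplacian of the logarithm of a round conformal factor. -/
theorem wD_wDbar_log_div (α : ℝ) (hα : 0 < α) (z : ℂ) :
    wD (fun w => wDbar (fun u => (Real.log (α / (1 + normSq u) ^ 2) : ℂ)) w) z =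
      -2 / (1 + z * conj z) ^ 2 := by
  have hlog : (fun u => (Real.log (α / (1 + normSq u) ^ 2) : ℂ)) =
      fun u => (Real.log α : ℂ) + (-2) * Complex.log (1 + u * conj u) := by
    funext u
    have h1 : 0 < 1 + normSq u := by linarith [normSq_nonneg u]
    rw [Real.log_div hα.ne' (by positivity), Real.log_pow, mul_conj, ← ofReal_one, ← ofReal_add,
      ← ofReal_log h1.le]
    push_cast
    ring
  have h1 (w : ℂ) : wDbar (fun u => (Real.log (α / (1 + normSq u) ^ 2) : ℂ)) w =
      (-2) * w / (1 + w * conj w) := by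
    have hs : 1 + w * conj w ∈ slitPlane := by
      rw [mul_conj, ← ofReal_one, ← ofReal_add, ofReal_mem_slitPlane]
      linarith [normSq_nonneg w]
    rw [hlog, ((HasWirtingerAt.const _ w).add ((HasWirtingerAt.const (-2) w).mul
      (HasWirtingerAt.scomp (hasDerivAt_log hs) (hasWirtingerAt_one_add_mul_conj w)))).wDbar_eq]
    ring
  simp only [h1]
  rw [(((HasWirtingerAt.const (-2) z).mul (HasWirtingerAt.id z)).div
    (hasWirtingerAt_one_add_mul_conj z) (one_add_mul_conj_ne_zero z)).wD_eq]
  ring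

/-- For the Veronese map and `0 ≤ k ≤ N−2`, with `P_k = P(P₊^k f)`
and `g_k = tr(∂P_k · ∂̄P_k)`, one has `g_k = α_k/(1+|ζ|²)²` with
`α_k = (k+1)(N−1−k) + k(N−k)`, and the Gaussian curvature
`K = −(4/g_k) ∂∂̄ ln g_k` is constant equal to `8/α_k`. -/
theorem stmt_13 (N : ℕ) (hN : 2 ≤ N) (k : ℕ) (hk : k ≤ N - 2) :
    let f : ℂ → Fin N → ℂ := fun z j => (Real.sqrt ((N - 1).choose (j : ℕ)) : ℂ) * z ^ (j : ℕ)
    let Pk : ℂ → Matrix (Fin N) (Fin N) ℂ := fun z => proj (PpIter f k) z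
    let gk : ℂ → ℂ := fun z => Matrix.trace (wDM Pk z * wDbarM Pk z)
    let α : ℝ := ((k + 1) * (N - 1 - k) + k * (N - k) : ℕ)
    ∀ ζ : ℂ,
      gk ζ = (α : ℂ) / (1 + Complex.normSq ζ) ^ 2 ∧
      -(4 / (((gk ζ).re : ℝ) : ℂ)) *
        wD (fun w => wDbar (fun u => (Real.log ((gk u).re) : ℂ)) w) ζ = ((8 / α : ℝ) : ℂ) := by
  intro f Pk gk α ζ
  obtain ⟨n, rfl⟩ : ∃ n, N = n + 1 := ⟨N - 1, by omega⟩
  have hkn : k < n := by omega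
  obtain ⟨U, hU⟩ := exists_isVeroneseStep_PpIter n k hkn.le
  have hα : α = (k + 1) * (n - k) + k * (n + 1 - k) := by
    simp only [α, Nat.add_sub_cancel]
    push_cast [Nat.cast_sub hkn.le, Nat.cast_sub (hkn.le.trans n.le_succ)]
    ring
  have hpos : 0 < α := by
    have : (k : ℝ) < n := by exact_mod_cast hkn
    rw [hα]
    have : 0 < (n : ℝ) - k := by linarith
    have : 0 < (n : ℝ) + 1 - k := by linarith
    positivity
  have hg (z : ℂ) : gk z = (α : ℂ) / (1 + normSq z) ^ 2 := by
    refine (hU.trace_wDM_mul_wDbarM z).trans ?_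
    rw [hα, ← mul_conj, veroneseRatio, veroneseRatio]
    push_cast
    ring
  have hre (z : ℂ) : (gk z).re = α / (1 + normSq z) ^ 2 := by
    rw [hg]
    exact_mod_cast ofReal_re (α / (1 + normSq z) ^ (2 : ℕ))
  refine ⟨hg ζ, ?_⟩
  simp only [hre]
  rw [wD_wDbar_log_div α hpos, mul_conj]
  have h1 : (1 + normSq ζ : ℂ) ≠ 0 := mul_conj ζ ▸ one_add_mul_conj_ne_zero ζ
  have h2 : (α : ℂ) ≠ 0 := ofReal_ne_zero.2 hpos.ne'
  push_cast
  field_simp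
  norm_num
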